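/- Let G be a finite DAG with vertex weights δ_a, μ_a, ρ_a and total-count function F(G) = ∑_{H full} (∏_{a∉H} δ_a)(∏_{b∈H∖S(H)} ρ_b)(∏_{e∈S(H)} μ_e). Suppose G is the disjoint union of DAGs G_1 and G_2. Then F(G) = F(G_1) · F(G_2). -/

import Mathlib

open scoped Classical in
/-- The sources of a subgraph `H`: vertices of `H` with no incoming edge from `H`. -/
noncomputable def graphSources {V : Type*} [Fintype V] (E : V → V → Prop)
    (H : Finset V) : Finset V :=
  H.filter fun s => ∀ v ∈ H, ¬ E v s

/-- The weight `w(H) = (∏_{a∉H} δ_a)(∏_{b∈H∖S(H)} ρ_b)(∏_{e∈S(H)} μ_e)`. -/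
noncomputable def graphWeight {V : Type*} [Fintype V] [DecidableEq V] (E : V → V → Prop)
    (δ ρ μ : V → ℕ) (H : Finset V) : ℕ :=
  (∏ a ∈ Hᶜ, δ a) * (∏ b ∈ H \ graphSources E H, ρ b) * ∏ e ∈ graphSources E H, μ e

open scoped Classical in
/-- The total count `F(G) = ∑_{H full} w(H)` over full (descendant-closed) subgraphs. -/
noncomputable def graphTotal {V : Type*} [Fintype V] [DecidableEq V] (E : V → V → Prop)
    (δ ρ μ : V → ℕ) : ℕ :=
  ∑ H ∈ Finset.univ.filter (fun H : Finset V => ∀ a ∈ H, ∀ b, E a b → b ∈ H),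
    graphWeight E δ ρ μ H

theorem graphSources_disjSum_aux {V₁ V₂ : Type*} [Fintype V₁] [Fintype V₂]
    (E : V₁ ⊕ V₂ → V₁ ⊕ V₂ → Prop) (E₁ : V₁ → V₁ → Prop) (E₂ : V₂ → V₂ → Prop)
    (h11 : ∀ a b, E (Sum.inl a) (Sum.inl b) ↔ E₁ a b)
    (h22 : ∀ a b, E (Sum.inr a) (Sum.inr b) ↔ E₂ a b)
    (h12 : ∀ a b, ¬ E (Sum.inl a) (Sum.inr b))
    (h21 : ∀ a b, ¬ E (Sum.inr a) (Sum.inl b)) (A : Finset V₁) (B : Finset V₂) :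
    graphSources E (A.disjSum B) = (graphSources E₁ A).disjSum (graphSources E₂ B) := by
  ext x
  rcases x with x | x <;>
    simp [graphSources, h11, h22, h12, h21]

theorem graphWeight_disjSum_aux {V₁ V₂ : Type*} [Fintype V₁] [Fintype V₂]
    [DecidableEq V₁] [DecidableEq V₂]
    (E : V₁ ⊕ V₂ → V₁ ⊕ V₂ → Prop) (E₁ : V₁ → V₁ → Prop) (E₂ : V₂ → V₂ → Prop)
    (h11 : ∀ a b, E (Sum.inl a) (Sum.inl b) ↔ E₁ a b)
    (h22 : ∀ a b, E (Sum.inr a) (Sum.inr b) ↔ E₂ a b)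
    (h12 : ∀ a b, ¬ E (Sum.inl a) (Sum.inr b))
    (h21 : ∀ a b, ¬ E (Sum.inr a) (Sum.inl b)) (δ ρ μ : V₁ ⊕ V₂ → ℕ)
    (A : Finset V₁) (B : Finset V₂) :
    graphWeight E δ ρ μ (A.disjSum B) =
      graphWeight E₁ (δ ∘ Sum.inl) (ρ ∘ Sum.inl) (μ ∘ Sum.inl) A *
      graphWeight E₂ (δ ∘ Sum.inr) (ρ ∘ Sum.inr) (μ ∘ Sum.inr) B := by
  have hc : (A.disjSum B)ᶜ = (Aᶜ).disjSum (Bᶜ) := by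
    ext x; rcases x with x | x <;> simp
  have hd : ∀ (C : Finset V₁) (D : Finset V₂),
      A.disjSum B \ C.disjSum D = (A \ C).disjSum (B \ D) := by
    intro C D
    ext x; rcases x with x | x <;> simp
  simp only [graphWeight, graphSources_disjSum_aux E E₁ E₂ h11 h22 h12 h21, hc, hd,
    Finset.prod_disjSum, Function.comp_apply]
  ring

theorem graphTotal_disjSum_aux {V₁ V₂ : Type*} [Fintype V₁] [Fintype V₂]
    [DecidableEq V₁] [DecidableEq V₂]
    (E : V₁ ⊕ V₂ → V₁ ⊕ V₂ → Prop) (E₁ : V₁ → V₁ → Prop) (E₂ : V₂ → V₂ → Prop)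
    (h11 : ∀ a b, E (Sum.inl a) (Sum.inl b) ↔ E₁ a b)
    (h22 : ∀ a b, E (Sum.inr a) (Sum.inr b) ↔ E₂ a b)
    (h12 : ∀ a b, ¬ E (Sum.inl a) (Sum.inr b))
    (h21 : ∀ a b, ¬ E (Sum.inr a) (Sum.inl b)) (δ ρ μ : V₁ ⊕ V₂ → ℕ) :
    graphTotal E δ ρ μ =
      graphTotal E₁ (δ ∘ Sum.inl) (ρ ∘ Sum.inl) (μ ∘ Sum.inl) *
      graphTotal E₂ (δ ∘ Sum.inr) (ρ ∘ Sum.inr) (μ ∘ Sum.inr) := by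
  unfold graphTotal
  rw [Finset.sum_mul_sum, ← Finset.sum_product']
  symm
  refine Finset.sum_bij' (fun p _ => p.1.disjSum p.2) (fun H _ => (H.toLeft, H.toRight))
    ?_ ?_ ?_ ?_ ?_
  · rintro ⟨A, B⟩ h
    simpa [h11, h22, h12, h21] using h
  · intro H h
    simpa [h11, h22, h12, h21] using h
  · rintro ⟨A, B⟩ h
    simp
  · intro H h
    ext x; rcases x with x | x <;> simp
  · rintro ⟨A, B⟩ h
    exact (graphWeight_disjSum_aux E E₁ E₂ h11 h22 h12 h21 δ ρ μ A B).symm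

/-- If a finite DAG `G` is the disjoint union of DAGs `G₁` and `G₂`, then
`F(G) = F(G₁) · F(G₂)`. -/
theorem stmt17 {V₁ V₂ : Type*} [Fintype V₁] [Fintype V₂] [DecidableEq V₁] [DecidableEq V₂]
    (E₁ : V₁ → V₁ → Prop) (E₂ : V₂ → V₂ → Prop)
    (hacyc₁ : ∀ v, ¬ Relation.TransGen E₁ v v)
    (hacyc₂ : ∀ v, ¬ Relation.TransGen E₂ v v)
    (δ ρ μ : V₁ ⊕ V₂ → ℕ) :
    graphTotal (fun a b => match a, b with
      | Sum.inl a, Sum.inl b => E₁ a b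
      | Sum.inr a, Sum.inr b => E₂ a b
      | _, _ => False) δ ρ μ =
    graphTotal E₁ (δ ∘ Sum.inl) (ρ ∘ Sum.inl) (μ ∘ Sum.inl) *
    graphTotal E₂ (δ ∘ Sum.inr) (ρ ∘ Sum.inr) (μ ∘ Sum.inr) := by
  apply graphTotal_disjSum_aux
  · intro a b; exact Iff.rfl
  · intro a b; exact Iff.rfl
  · intro a b h; exact h
  · intro a b h; exact h
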